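/- Let I ⊆ A and J ⊆ B be monomial ideals and γ = (α,β) ∈ ℤ^σ × ℤ^τ. Then Δ_γ(I·J) = (Δ_α(I) ∗ Δ_τ) ∪ (Δ_σ ∗ Δ_β(J)), where Δ_σ and Δ_τ are the full simplices on σ and τ; that is, for every subset F of (σ ⊔ τ)∖G_γ, F ∈ Δ_γ(I·J) if and only if F ∩ σ ∈ Δ_α(I) or F ∩ τ ∈ Δ_β(J). -/

import Mathlib

open MvPolynomial

noncomputable section

variable (k : Type*) [Field k]

/-- The multiplicative submonoid of `S = k[x_i : i ∈ σ]` generated by the variables `x_i, i ∈ F`. -/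
def varSubmonoid (σ : Type*) (F : Set σ) : Submonoid (MvPolynomial σ k) :=
  Submonoid.closure ((fun i => (X i : MvPolynomial σ k)) '' F)

/-- The localization `S_F` of `S` at the variables indexed by `F`. -/
abbrev Loc (σ : Type*) (F : Set σ) : Type _ := Localization (varSubmonoid k σ F)

/-- The ideal `I S_F` of `S_F` generated by the image of `I`. -/
def locIdeal {σ : Type*} (I : Ideal (MvPolynomial σ k)) (F : Set σ) : Ideal (Loc k σ F) :=
  Ideal.map (algebraMap (MvPolynomial σ k) (Loc k σ F)) I

/-- `G_γ = {i | γ i < 0}`. -/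
def negSupp {σ : Type*} (γ : σ → ℤ) : Set σ := {i | γ i < 0}

/-- The element `x^γ` of `S_F` (meaningful when `G_γ ⊆ F`):  the image of the monomial with
exponents `max (γ i) 0` multiplied by the inverse of the image of `∏ x_i ^ (-γ i)` over `G_γ`. -/
def xpow {σ : Type*} [Fintype σ] (F : Set σ) (γ : σ → ℤ) : Loc k σ F :=
  algebraMap (MvPolynomial σ k) (Loc k σ F) (∏ i, X i ^ (γ i).toNat) *
    Ring.inverse (algebraMap (MvPolynomial σ k) (Loc k σ F) (∏ i, X i ^ (-γ i).toNat))

/-- The degree complex `Δ_γ(I)`: all `F ⊆ σ \ G_γ` with `x^γ ∉ I S_{F ∪ G_γ}`. -/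
def degCx {σ : Type*} [Fintype σ] (I : Ideal (MvPolynomial σ k)) (γ : σ → ℤ) : Set (Set σ) :=
  {F | F ⊆ (negSupp γ)ᶜ ∧ xpow k (F ∪ negSupp γ) γ ∉ locIdeal k I (F ∪ negSupp γ)}

/-- A monomial ideal is an ideal generated by monomials. -/
def IsMonomialIdeal {σ : Type*} (I : Ideal (MvPolynomial σ k)) : Prop :=
  ∃ G : Set (σ →₀ ℕ),
    I = Ideal.span ((fun d => (monomial d (1 : k) : MvPolynomial σ k)) '' G)

/-- Extension of an ideal of `A = k[x_i : i ∈ σ]` to `S = k[x_i : i ∈ σ ⊕ τ]` along the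
renaming of variables by `Sum.inl`. -/
def extL {σ τ : Type*} (I : Ideal (MvPolynomial σ k)) : Ideal (MvPolynomial (σ ⊕ τ) k) :=
  Ideal.map (rename (Sum.inl : σ → σ ⊕ τ) :
    MvPolynomial σ k →ₐ[k] MvPolynomial (σ ⊕ τ) k).toRingHom I

/-- Extension of an ideal of `B = k[x_i : i ∈ τ]` to `S = k[x_i : i ∈ σ ⊕ τ]` along the
renaming of variables by `Sum.inr`. -/
def extR {σ τ : Type*} (J : Ideal (MvPolynomial τ k)) : Ideal (MvPolynomial (σ ⊕ τ) k) :=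
  Ideal.map (rename (Sum.inr : τ → σ ⊕ τ) :
    MvPolynomial τ k →ₐ[k] MvPolynomial (σ ⊕ τ) k).toRingHom J

/-- The maximal homogeneous ideal, generated by all the variables. -/
def maxIdeal (σ : Type*) : Ideal (MvPolynomial σ k) :=
  Ideal.span (Set.range (X : σ → MvPolynomial σ k))

theorem prod_X_pow_eq_monomial_equivFunOnFinite {σ : Type*} [Fintype σ] (f : σ → ℕ) :
    ∏ i, (X i : MvPolynomial σ k) ^ f i = monomial (Finsupp.equivFunOnFinite.symm f) 1 := by
  rw [monomial_eq, Finsupp.prod_fintype _ _ (by simp)]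
  simp

theorem X_pow_mem_varSubmonoid {σ : Type*} {F : Set σ} {i : σ} {n : ℕ} (h : n ≠ 0 → i ∈ F) :
    (X i : MvPolynomial σ k) ^ n ∈ varSubmonoid k σ F := by
  rcases eq_or_ne n 0 with rfl | hn
  · simp [one_mem]
  · exact pow_mem (Submonoid.subset_closure (Set.mem_image_of_mem _ (h hn))) n

theorem exists_eq_monomial_of_mem_varSubmonoid {σ : Type*} {F : Set σ} {m : MvPolynomial σ k}
    (hm : m ∈ varSubmonoid k σ F) :
    ∃ e : σ →₀ ℕ, (∀ i ∉ F, e i = 0) ∧ m = monomial e 1 := by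
  induction hm using Submonoid.closure_induction with
  | mem x hx =>
    obtain ⟨j, hj, rfl⟩ := hx
    refine ⟨Finsupp.single j 1, fun i hi => Finsupp.single_eq_of_ne fun h => hi (h ▸ hj), rfl⟩
  | one => exact ⟨0, by simp, rfl⟩
  | mul x y _ _ hx hy =>
    obtain ⟨e, he, rfl⟩ := hx
    obtain ⟨f, hf, rfl⟩ := hy
    exact ⟨e + f, fun i hi => by simp [he i hi, hf i hi], by simp [monomial_mul]⟩

theorem monomial_mem_span_monomial_iff {σ : Type*} (G : Set (σ →₀ ℕ)) (e : σ →₀ ℕ) :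
    (monomial e (1 : k) : MvPolynomial σ k) ∈
      Ideal.span ((fun d => (monomial d (1 : k) : MvPolynomial σ k)) '' G) ↔
      ∃ d ∈ G, d ≤ e := by
  classical
  rw [mem_ideal_span_monomial_image]
  simp [support_monomial]

/-- A Laurent monomial lies in the localization of a monomial ideal iff its exponents dominate
those of some generator at the variables that are not inverted. -/
theorem xpow_mem_locIdeal_span_iff {σ : Type*} [Fintype σ] (G : Set (σ →₀ ℕ)) (γ : σ → ℤ)
    {F : Set σ} (hF : negSupp γ ⊆ F) :
    xpow k F γ ∈ locIdeal k
        (Ideal.span ((fun d => (monomial d (1 : k) : MvPolynomial σ k)) '' G)) F ↔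
      ∃ d ∈ G, ∀ i ∉ F, (d i : ℤ) ≤ γ i := by
  have hu : IsUnit (Ring.inverse (algebraMap (MvPolynomial σ k) (Loc k σ F)
      (∏ i, X i ^ (-γ i).toNat))) := by
    refine IsUnit.ringInverse (IsLocalization.map_units (Loc k σ F)
      (⟨_, prod_mem fun i _ => X_pow_mem_varSubmonoid k fun h => hF ?_⟩ : varSubmonoid k σ F))
    simp only [negSupp, Set.mem_ofPred_eq]
    omega
  rw [xpow, locIdeal, Ideal.mul_unit_mem_iff_mem _ hu,
    IsLocalization.algebraMap_mem_map_algebraMap_iff (varSubmonoid k σ F),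
    prod_X_pow_eq_monomial_equivFunOnFinite]
  constructor
  · rintro ⟨m, hm, h⟩
    obtain ⟨e, he, rfl⟩ := exists_eq_monomial_of_mem_varSubmonoid k hm
    rw [monomial_mul, one_mul, monomial_mem_span_monomial_iff] at h
    obtain ⟨d, hd, hle⟩ := h
    refine ⟨d, hd, fun i hi => ?_⟩
    have h1 := hle i
    have h2 : ¬ γ i < 0 := fun h => hi (hF h)
    simp [he i hi] at h1
    omega
  · rintro ⟨d, hd, h⟩
    classical
    refine ⟨∏ i, X i ^ (if i ∈ F then d i else 0),
      prod_mem fun i _ => X_pow_mem_varSubmonoid k fun h => by simp_all, ?_⟩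
    rw [prod_X_pow_eq_monomial_equivFunOnFinite, monomial_mul, one_mul,
      monomial_mem_span_monomial_iff]
    refine ⟨d, hd, fun i => ?_⟩
    by_cases hi : i ∈ F
    · simp [hi]
    · have := h i hi
      simp [hi]
      omega

theorem map_rename_span_monomial {σ ρ : Type*} (f : σ → ρ) (G : Set (σ →₀ ℕ)) :
    Ideal.map (rename f : MvPolynomial σ k →ₐ[k] MvPolynomial ρ k).toRingHom
        (Ideal.span ((fun d => (monomial d (1 : k) : MvPolynomial σ k)) '' G)) =
      Ideal.span ((fun d => (monomial d (1 : k) : MvPolynomial ρ k)) ''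
        (Finsupp.mapDomain f '' G)) := by
  rw [Ideal.map_span, Set.image_image, Set.image_image]
  simp [rename_monomial]

open scoped Pointwise in
theorem span_monomial_mul_span_monomial {σ : Type*} (G H : Set (σ →₀ ℕ)) :
    Ideal.span ((fun d => (monomial d (1 : k) : MvPolynomial σ k)) '' G) *
        Ideal.span ((fun d => (monomial d (1 : k) : MvPolynomial σ k)) '' H) =
      Ideal.span ((fun d => (monomial d (1 : k) : MvPolynomial σ k)) '' (G + H)) := by
  rw [Ideal.span_mul_span]
  congr 1
  exact (Set.image_image2_distrib fun a b => by simp [monomial_mul]).symm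

/-- for monomial ideals `I ⊆ A`, `J ⊆ B` and `γ = (α, β)`,
`Δ_γ(I·J) = (Δ_α(I) ∗ Δ_τ) ∪ (Δ_σ ∗ Δ_β(J))`: for every `F ⊆ (σ ⊔ τ) \ G_γ`,
`F ∈ Δ_γ(I·J)` iff `F ∩ σ ∈ Δ_α(I)` or `F ∩ τ ∈ Δ_β(J)`. -/
theorem statement9 {σ τ : Type*} [Fintype σ] [Fintype τ]
    (I : Ideal (MvPolynomial σ k)) (J : Ideal (MvPolynomial τ k))
    (hI : IsMonomialIdeal k I) (hJ : IsMonomialIdeal k J) (α : σ → ℤ) (β : τ → ℤ) :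
    ∀ F : Set (σ ⊕ τ), F ⊆ (negSupp (Sum.elim α β))ᶜ →
      (F ∈ degCx k (extL k I * extR k J) (Sum.elim α β) ↔
        Sum.inl ⁻¹' F ∈ degCx k I α ∨ Sum.inr ⁻¹' F ∈ degCx k J β) := by
  intro F hF
  obtain ⟨G, rfl⟩ := hI
  obtain ⟨H, rfl⟩ := hJ
  have hα : Sum.inl ⁻¹' F ⊆ (negSupp α)ᶜ := fun i hi => hF hi
  have hβ : Sum.inr ⁻¹' F ⊆ (negSupp β)ᶜ := fun i hi => hF hi
  simp only [degCx, Set.mem_ofPred_eq, hF, hα, hβ, true_and]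
  rw [extL, extR, map_rename_span_monomial, map_rename_span_monomial,
    span_monomial_mul_span_monomial, xpow_mem_locIdeal_span_iff k _ _ Set.subset_union_right,
    xpow_mem_locIdeal_span_iff k _ _ Set.subset_union_right,
    xpow_mem_locIdeal_span_iff k _ _ Set.subset_union_right, ← not_and_or, not_iff_not]
  have hl (d : σ →₀ ℕ) (e : τ →₀ ℕ) (i : σ) :
      (d.mapDomain Sum.inl + e.mapDomain Sum.inr : σ ⊕ τ →₀ ℕ) (Sum.inl i) = d i := by
    simp [Finsupp.mapDomain_apply Sum.inl_injective, Finsupp.mapDomain_of_notMem_range]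
  have hr (d : σ →₀ ℕ) (e : τ →₀ ℕ) (j : τ) :
      (d.mapDomain Sum.inl + e.mapDomain Sum.inr : σ ⊕ τ →₀ ℕ) (Sum.inr j) = e j := by
    simp [Finsupp.mapDomain_apply Sum.inr_injective, Finsupp.mapDomain_of_notMem_range]
  constructor
  · rintro ⟨_, ⟨_, ⟨d, hd, rfl⟩, _, ⟨e, he, rfl⟩, rfl⟩, h⟩
    exact ⟨⟨d, hd, fun i hi => by simpa only [hl, Sum.elim_inl] using h (Sum.inl i) hi⟩,
      ⟨e, he, fun j hj => by simpa only [hr, Sum.elim_inr] using h (Sum.inr j) hj⟩⟩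
  · rintro ⟨⟨d, hd, h₁⟩, e, he, h₂⟩
    refine ⟨_, Set.add_mem_add ⟨d, hd, rfl⟩ ⟨e, he, rfl⟩, ?_⟩
    rintro (i | j) hi
    · simpa only [hl, Sum.elim_inl] using h₁ i hi
    · simpa only [hr, Sum.elim_inr] using h₂ j hi
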